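/- Let H(q,p) : ℝ^d × ℝ^d → ℝ be a C² autonomous Hamiltonian satisfying: ‖d²H‖ ≤ M everywhere; ∂²_{pp} H ≥ m·Id in the sense of quadratic forms everywhere; and (m/2)|p|² − M ≤ H(q,p) ≤ (M/2)|p|² + M everywhere, with constants 0 < m ≤ M. Let α be the critical value of H. Then there exists a C^{1,1} sub-solution at the critical level, i.e. a function u : ℝ^d → ℝ, differentiable with Lipschitz differential, such that H(q, du(q)) ≤ α for all q ∈ ℝ^d. -/

import Mathlib

open scoped RealInnerProductSpace NNReal
open Set

section SecondDifference

variable {F : Type*} [NormedAddCommGroup F] [NormedSpace ℝ F]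

theorem le_weighted_second_difference_real {g g' g'' : ℝ → ℝ} {c : ℝ}
    (hg : ∀ s, HasDerivAt g (g' s) s) (hg' : ∀ s, HasDerivAt g' (g'' s) s) (hc : ∀ s, c ≤ g'' s)
    {a b : ℝ} (ha : 0 ≤ a) (hb : 0 ≤ b) (hab : a + b = 1) :
    a * b * (c / 2) ≤ a * g b + b * g (-a) - g 0 := by
  have h1 : ∀ s, HasDerivAt (fun s => g s - c / 2 * s ^ 2) (g' s - c * s) s := fun s => by
    refine ((hg s).sub (((hasDerivAt_pow 2 s).const_mul (c / 2)))).congr_deriv ?_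
    simp; ring
  have h2 : ∀ s, HasDerivAt (fun s => g' s - c * s) (g'' s - c) s := fun s => by
    refine ((hg' s).sub ((hasDerivAt_id s).const_mul c)).congr_deriv ?_
    simp
  have e1 : deriv (fun s => g s - c / 2 * s ^ 2) = fun s => g' s - c * s :=
    funext fun s => (h1 s).deriv
  have e2 : deriv (fun s => g' s - c * s) = fun s => g'' s - c := funext fun s => (h2 s).deriv
  have hconv : ConvexOn ℝ univ (fun s => g s - c / 2 * s ^ 2) := by
    refine convexOn_univ_of_deriv2_nonneg (fun s => (h1 s).differentiableAt) ?_ ?_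
    · rw [e1]; exact fun s => (h2 s).differentiableAt
    · intro s
      simp only [Function.iterate_succ, Function.iterate_zero, Function.comp_apply, id, e1, e2]
      linarith [hc s]
  have key := hconv.2 (mem_univ b) (mem_univ (-a)) ha hb hab
  have h0 : a * b + b * -a = 0 := by ring
  simp only [smul_eq_mul, h0] at key
  obtain rfl : a = 1 - b := by linarith
  nlinarith

theorem le_weighted_second_difference {f : F → ℝ} (hf : ContDiff ℝ 2 f) {x ξ : F} {c : ℝ}
    (hc : ∀ y, c ≤ fderiv ℝ (fderiv ℝ f) y ξ ξ)
    {a b : ℝ} (ha : 0 ≤ a) (hb : 0 ≤ b) (hab : a + b = 1) :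
    a * b * (c / 2) ≤ a * f (x + b • ξ) + b * f (x - a • ξ) - f x := by
  have hline : ∀ s : ℝ, HasDerivAt (fun s : ℝ => x + s • ξ) ξ s := fun s => by
    simpa using ((hasDerivAt_id s).smul_const ξ).const_add x
  have hf1 : ContDiff ℝ 1 (fderiv ℝ f) := hf.fderiv_right (by norm_num)
  have h := le_weighted_second_difference_real (g := fun s => f (x + s • ξ))
    (g' := fun s => fderiv ℝ f (x + s • ξ) ξ)
    (g'' := fun s => fderiv ℝ (fderiv ℝ f) (x + s • ξ) ξ ξ) (c := c)
    (fun s => ((hf.differentiable (by norm_num) _).hasFDerivAt.comp_hasDerivAt s (hline s)))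
    (fun s => by
      have := ((hf1.differentiable (by norm_num) _).hasFDerivAt.comp_hasDerivAt s (hline s))
      simpa using this.clm_apply (hasDerivAt_const s ξ))
    (fun s => hc _) ha hb hab
  simpa [sub_eq_add_neg] using h

end SecondDifference

section Hamiltonian

variable {E : Type*} [NormedAddCommGroup E] [InnerProductSpace ℝ E]

/-- Two-sided bounds, in weighted second-difference form, for a function on the phase space:
semi-concavity with constant `M` and semi-convexity which is strict in the momentum. -/
structure PhaseBounds (H : E → E → ℝ) (m M C : ℝ) : Prop where
  pos : 0 < m
  le : m ≤ M
  nonneg : 0 ≤ C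
  lower : ∀ q p, m / 2 * ‖p‖ ^ 2 - M ≤ H q p
  upper : ∀ q p, H q p ≤ M / 2 * ‖p‖ ^ 2 + M
  second_le : ∀ {a b : ℝ}, 0 ≤ a → 0 ≤ b → a + b = 1 → ∀ q p h k,
    a * H (q + b • h) (p + b • k) + b * H (q - a • h) (p - a • k) - H q p
      ≤ a * b * (M / 2 * (‖h‖ ^ 2 + ‖k‖ ^ 2))
  le_second : ∀ {a b : ℝ}, 0 ≤ a → 0 ≤ b → a + b = 1 → ∀ q p h k,
    a * b * (m / 4 * ‖k‖ ^ 2 - C * ‖h‖ ^ 2)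
      ≤ a * H (q + b • h) (p + b • k) + b * H (q - a • h) (p - a • k) - H q p

theorem fderiv_fderiv_partial {H : E → E → ℝ}
    (hH : ContDiff ℝ 2 (fun x : E × E => H x.1 x.2)) (q p v : E) :
    fderiv ℝ (fderiv ℝ (fun p' => H q p')) p v v =
      fderiv ℝ (fderiv ℝ (fun x : E × E => H x.1 x.2)) (q, p) (0, v) (0, v) := by
  set f : E × E → ℝ := fun x => H x.1 x.2 with hf
  have hf1 : ContDiff ℝ 1 (fderiv ℝ f) := hH.fderiv_right (by norm_num)
  have hpair : ∀ p, HasFDerivAt (fun p' : E => (q, p')) (ContinuousLinearMap.inr ℝ E E) p :=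
    fun p => hasFDerivAt_prodMk_right q p
  have h1 : fderiv ℝ (fun p' => H q p') =
      fun p => (fderiv ℝ f (q, p)).comp (ContinuousLinearMap.inr ℝ E E) := by
    funext p
    exact ((hH.differentiable (by norm_num) (q, p)).hasFDerivAt.comp p (hpair p)).fderiv
  have h2 : HasFDerivAt (fun p' => fderiv ℝ f (q, p'))
      ((fderiv ℝ (fderiv ℝ f) (q, p)).comp (ContinuousLinearMap.inr ℝ E E)) p :=
    (hf1.differentiable (by norm_num) (q, p)).hasFDerivAt.comp p (hpair p)
  rw [h1]
  rw [(h2.clm_comp (hasFDerivAt_const (ContinuousLinearMap.inr ℝ E E) p)).fderiv]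
  simp

theorem phaseBounds_of_contDiff {H : E → E → ℝ} {m M : ℝ}
    (hH : ContDiff ℝ 2 (fun x : E × E => H x.1 x.2)) (hm : 0 < m) (hmM : m ≤ M)
    (hd2H : ∀ x : E × E, ‖iteratedFDeriv ℝ 2 (fun y : E × E => H y.1 y.2) x‖ ≤ M)
    (hconv : ∀ q p v : E, m * ‖v‖ ^ 2 ≤ iteratedFDeriv ℝ 2 (fun p' => H q p') p ![v, v])
    (hlower : ∀ q p : E, m / 2 * ‖p‖ ^ 2 - M ≤ H q p)
    (hupper : ∀ q p : E, H q p ≤ M / 2 * ‖p‖ ^ 2 + M) :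
    PhaseBounds H m M (M + M ^ 2 / m) := by
  set f : E × E → ℝ := fun x => H x.1 x.2 with hf
  have hM : 0 < M := hm.trans_le hmM
  have hB : ∀ x ξ η, |fderiv ℝ (fderiv ℝ f) x ξ η| ≤ M * ‖ξ‖ * ‖η‖ := fun x ξ η => by
    have h1 := (iteratedFDeriv ℝ 2 f x).le_opNorm ![ξ, η]
    rw [iteratedFDeriv_two_apply] at h1
    simp only [Fin.prod_univ_two, Matrix.cons_val_zero, Matrix.cons_val_one, Real.norm_eq_abs]
      at h1
    refine h1.trans ?_
    rw [mul_assoc]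
    exact mul_le_mul_of_nonneg_right (hd2H x) (by positivity)
  have hQ : ∀ h k : E, ‖((h, k) : E × E)‖ ^ 2 ≤ ‖h‖ ^ 2 + ‖k‖ ^ 2 := fun h k => by
    rw [Prod.norm_def]
    rcases max_cases ‖h‖ ‖k‖ with ⟨e, _⟩ | ⟨e, _⟩ <;> rw [e] <;>
      nlinarith [sq_nonneg ‖h‖, sq_nonneg ‖k‖]
  refine ⟨hm, hmM, by positivity, hlower, hupper, ?_, ?_⟩
  · intro a b ha hb hab q p h k
    have hneg : ContDiff ℝ 2 (fun x => -f x) := hH.neg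
    have := le_weighted_second_difference hneg (x := (q, p)) (ξ := (h, k))
      (c := -(M * (‖h‖ ^ 2 + ‖k‖ ^ 2))) (fun y => by
        have e : fderiv ℝ (fun x => -f x) = fun x => -fderiv ℝ f x := by
          funext x; exact fderiv_fun_neg
        rw [e, fderiv_fun_neg]
        have h1 := (abs_le.1 (hB y (h, k) (h, k))).2
        have h2 := mul_le_mul_of_nonneg_left (hQ h k) hM.le
        simp only [neg_apply]
        nlinarith) ha hb hab
    simp only [hf, Prod.smul_mk, Prod.mk_add_mk, Prod.mk_sub_mk] at this
    linarith
  · intro a b ha hb hab q p h k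
    have := le_weighted_second_difference hH (x := (q, p)) (ξ := (h, k))
      (c := 2 * (m / 4 * ‖k‖ ^ 2 - (M + M ^ 2 / m) * ‖h‖ ^ 2)) (fun y => by
        have e : ((h, k) : E × E) = (h, 0) + (0, k) := by simp
        have n1 : ‖((h, 0) : E × E)‖ = ‖h‖ := by simp [Prod.norm_def]
        have n2 : ‖((0, k) : E × E)‖ = ‖k‖ := by simp [Prod.norm_def]
        have h1 := (abs_le.1 (hB y (h, 0) (h, 0))).1
        have h2 := (abs_le.1 (hB y (h, 0) (0, k))).1
        have h3 := (abs_le.1 (hB y (0, k) (h, 0))).1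
        have h4 := hconv y.1 y.2 k
        rw [iteratedFDeriv_two_apply] at h4
        simp only [Matrix.cons_val_zero, Matrix.cons_val_one] at h4
        rw [fderiv_fderiv_partial hH] at h4
        rw [n1] at h1
        rw [n1, n2] at h2
        rw [n1, n2] at h3
        rw [e]
        simp only [map_add, add_apply]
        have h5 : 0 ≤ (m * ‖k‖ - 2 * M * ‖h‖) ^ 2 / (2 * m) := by positivity
        have h6 : (m * ‖k‖ - 2 * M * ‖h‖) ^ 2 / (2 * m) =
            m / 2 * ‖k‖ ^ 2 - 2 * M * ‖h‖ * ‖k‖ + 2 * (M ^ 2 / m) * ‖h‖ ^ 2 := by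
          field_simp; ring
        have h7 : 0 ≤ M * ‖h‖ ^ 2 := by positivity
        nlinarith) ha hb hab
    simp only [hf, Prod.smul_mk, Prod.mk_add_mk, Prod.mk_sub_mk] at this
    linarith

end Hamiltonian

section Convex

variable {E : Type*} [NormedAddCommGroup E] [InnerProductSpace ℝ E] [FiniteDimensional ℝ E]

theorem ConvexOn.exists_subgradient {φ : E → ℝ} (hφ : ConvexOn ℝ univ φ) (x : E) :
    ∃ g : E, ∀ y, φ x + ⟪g, y - x⟫ ≤ φ y := by
  have hcont : Continuous φ := hφ.locallyLipschitz.continuous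
  have hconv : Convex ℝ {z : E × ℝ | z.1 ∈ univ ∧ φ z.1 < z.2} := hφ.convex_strict_epigraph
  have hopen : IsOpen {z : E × ℝ | z.1 ∈ univ ∧ φ z.1 < z.2} := by
    simp only [mem_univ, true_and]
    exact isOpen_lt (hcont.comp continuous_fst) continuous_snd
  obtain ⟨f, hf⟩ := geometric_hahn_banach_open_point hconv hopen (x := (x, φ x)) (by simp)
  have hsplit : ∀ y r, f (y, r) = f (y, 0) + r * f (0, 1) := fun y r => by
    have : ((y, r) : E × ℝ) = (y, 0) + r • (0, 1) := by simp
    rw [this, map_add, map_smul, smul_eq_mul]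
  have hc : f (0, 1) < 0 := by
    have := hf (x, φ x + 1) (by simp)
    rw [hsplit, hsplit x (φ x)] at this
    linarith
  set c := f (0, 1)
  have hle : ∀ y, f (y, 0) + φ y * c ≤ f (x, 0) + φ x * c := fun y => by
    refine le_of_forall_pos_le_add fun ε hε => ?_
    have := hf (y, φ y + ε / (-c)) (by simp [hc, hε])
    rw [hsplit, hsplit x (φ x)] at this
    have e : ε / (-c) * c = -ε := by field_simp [hc.ne]
    change f (y, 0) + (φ y + ε / (-c)) * c < f (x, 0) + φ x * c at this
    rw [add_mul, e] at this
    linarith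
  let ℓ : E →L[ℝ] ℝ := (-c)⁻¹ • f.comp (ContinuousLinearMap.inl ℝ E ℝ)
  refine ⟨(InnerProductSpace.toDual ℝ E).symm ℓ, fun y => ?_⟩
  rw [InnerProductSpace.toDual_symm_apply]
  have e : ℓ (y - x) = (f (y, 0) - f (x, 0)) / (-c) := by
    simp only [ℓ, _root_.smul_apply, ContinuousLinearMap.comp_apply, map_sub,
      ContinuousLinearMap.inl_apply, smul_eq_mul]
    ring
  rw [e, ← le_sub_iff_add_le', div_le_iff₀ (by linarith)]
  linarith [hle y]

end Convex

section Lagrangian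

variable {E : Type*} [NormedAddCommGroup E] [InnerProductSpace ℝ E]
  {H : E → E → ℝ} {m M C : ℝ}

/-- The Lagrangian of `H`, its fibrewise Legendre–Fenchel transform. -/
noncomputable def lagrangian (H : E → E → ℝ) (q v : E) : ℝ := ⨆ p, (⟪p, v⟫ - H q p)

namespace PhaseBounds

theorem pos' (hH : PhaseBounds H m M C) : 0 < M := hH.pos.trans_le hH.le

theorem inner_sub_le (hH : PhaseBounds H m M C) (q p v : E) :
    ⟪p, v⟫ - H q p ≤ ‖v‖ ^ 2 / (2 * m) + M := by
  have hm := hH.pos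
  have h1 := real_inner_le_norm p v
  have h2 := hH.lower q p
  have h3 : 0 ≤ (m * ‖p‖ - ‖v‖) ^ 2 / (2 * m) := by positivity
  have h4 : (m * ‖p‖ - ‖v‖) ^ 2 / (2 * m) =
      m / 2 * ‖p‖ ^ 2 - ‖p‖ * ‖v‖ + ‖v‖ ^ 2 / (2 * m) := by field_simp; ring
  linarith

theorem fenchel (hH : PhaseBounds H m M C) (q p v : E) :
    ⟪p, v⟫ - H q p ≤ lagrangian H q v :=
  le_ciSup (f := fun p => ⟪p, v⟫ - H q p)
    ⟨_, by rintro _ ⟨p, rfl⟩; exact hH.inner_sub_le q p v⟩ p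

theorem lagrangian_le_of_forall {q v : E} {r : ℝ}
    (h : ∀ p, ⟪p, v⟫ - H q p ≤ r) : lagrangian H q v ≤ r :=
  ciSup_le h

theorem lagrangian_le (hH : PhaseBounds H m M C) (q v : E) :
    lagrangian H q v ≤ ‖v‖ ^ 2 / (2 * m) + M :=
  lagrangian_le_of_forall fun p => hH.inner_sub_le q p v

theorem le_lagrangian (hH : PhaseBounds H m M C) (q v : E) :
    ‖v‖ ^ 2 / (2 * M) - M ≤ lagrangian H q v := by
  have hM := hH.pos'
  have h1 := hH.fenchel q (M⁻¹ • v) v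
  have h2 := hH.upper q (M⁻¹ • v)
  rw [real_inner_smul_left, real_inner_self_eq_norm_sq] at h1
  rw [norm_smul, mul_pow, Real.norm_eq_abs, sq_abs] at h2
  have h3 : M⁻¹ * ‖v‖ ^ 2 - M / 2 * (M⁻¹ ^ 2 * ‖v‖ ^ 2) = ‖v‖ ^ 2 / (2 * M) := by
    field_simp; ring
  linarith

theorem exists_lt_inner_sub (q v : E) {ε : ℝ} (hε : 0 < ε) :
    ∃ p, lagrangian H q v - ε < ⟪p, v⟫ - H q p :=
  exists_lt_of_lt_ciSup (sub_lt_self _ hε)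

theorem lagrangian_second_le (hH : PhaseBounds H m M C) {a b : ℝ} (ha : 0 ≤ a) (hb : 0 ≤ b)
    (hab : a + b = 1) (q v h w : E) :
    a * lagrangian H (q + b • h) (v + b • w) + b * lagrangian H (q - a • h) (v - a • w)
      - lagrangian H q v ≤ a * b * (‖w‖ ^ 2 / m + C * ‖h‖ ^ 2) := by
  have hm := hH.pos
  refine le_of_forall_pos_le_add fun ε hε => ?_
  obtain ⟨p₁, h₁⟩ := exists_lt_inner_sub (H := H) (q + b • h) (v + b • w) hε
  obtain ⟨p₂, h₂⟩ := exists_lt_inner_sub (H := H) (q - a • h) (v - a • w) hε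
  set p := a • p₁ + b • p₂ with hp
  set δ := p₁ - p₂ with hδ
  have e₁ : p₁ = p + b • δ := by
    obtain rfl : a = 1 - b := by linarith
    rw [hp, hδ]; module
  have e₂ : p₂ = p - a • δ := by
    obtain rfl : b = 1 - a := by linarith
    rw [hp, hδ]; module
  rw [e₁] at h₁
  rw [e₂] at h₂
  have h₃ := hH.fenchel q p v
  have h₄ := hH.le_second ha hb hab q p h δ
  have h₅ : a * ⟪p + b • δ, v + b • w⟫ + b * ⟪p - a • δ, v - a • w⟫ = ⟪p, v⟫ + a * b * ⟪δ, w⟫ := by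
    simp only [inner_add_left, inner_sub_left, inner_add_right, inner_sub_right,
      real_inner_smul_left, real_inner_smul_right]
    obtain rfl : a = 1 - b := by linarith
    ring
  have h₆ : ⟪δ, w⟫ ≤ m / 4 * ‖δ‖ ^ 2 + ‖w‖ ^ 2 / m := by
    have h1 := real_inner_le_norm δ w
    have h3 : 0 ≤ (m * ‖δ‖ - 2 * ‖w‖) ^ 2 / (4 * m) := by positivity
    have h4 : (m * ‖δ‖ - 2 * ‖w‖) ^ 2 / (4 * m) =
      m / 4 * ‖δ‖ ^ 2 - ‖δ‖ * ‖w‖ + ‖w‖ ^ 2 / m := by field_simp; ring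
    linarith
  have h₇ := mul_le_mul_of_nonneg_left h₁.le ha
  have h₈ := mul_le_mul_of_nonneg_left h₂.le hb
  have h₉ := mul_le_mul_of_nonneg_left h₆ (mul_nonneg ha hb)
  have h10 : a * ε + b * ε = ε := by rw [← add_mul, hab, one_mul]
  nlinarith

theorem le_lagrangian_second (hH : PhaseBounds H m M C) {a b : ℝ} (ha : 0 ≤ a) (hb : 0 ≤ b)
    (hab : a + b = 1) (q v h w : E) :
    a * b * (‖w‖ ^ 2 / (2 * M) - M / 2 * ‖h‖ ^ 2) ≤
    a * lagrangian H (q + b • h) (v + b • w) + b * lagrangian H (q - a • h) (v - a • w)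
      - lagrangian H q v := by
  have hM := hH.pos'
  refine le_of_forall_pos_le_add fun ε hε => ?_
  obtain ⟨p, hp⟩ := exists_lt_inner_sub (H := H) q v hε
  set δ := M⁻¹ • w with hδ
  have h₁ := hH.fenchel (q + b • h) (p + b • δ) (v + b • w)
  have h₂ := hH.fenchel (q - a • h) (p - a • δ) (v - a • w)
  have h₄ := hH.second_le ha hb hab q p h δ
  have h₅ : a * ⟪p + b • δ, v + b • w⟫ + b * ⟪p - a • δ, v - a • w⟫ = ⟪p, v⟫ + a * b * ⟪δ, w⟫ := by
    simp only [inner_add_left, inner_sub_left, inner_add_right, inner_sub_right,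
      real_inner_smul_left, real_inner_smul_right]
    obtain rfl : a = 1 - b := by linarith
    ring
  have h₆ : ⟪δ, w⟫ = ‖w‖ ^ 2 / (2 * M) + M / 2 * ‖δ‖ ^ 2 := by
    rw [hδ, real_inner_smul_left, real_inner_self_eq_norm_sq, norm_smul, mul_pow,
      Real.norm_eq_abs, sq_abs]
    field_simp; ring
  have h₇ := mul_le_mul_of_nonneg_left h₁ ha
  have h₈ := mul_le_mul_of_nonneg_left h₂ hb
  rw [h₆] at h₅
  nlinarith

theorem lagrangian_le_add (hH : PhaseBounds H m M C) {V : ℝ} {v : E} (hv : ‖v‖ ≤ V) {q y : E}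
    (hy : ‖y - q‖ ≤ 1) :
    lagrangian H y v ≤ lagrangian H q v + ‖y - q‖ * (V ^ 2 / (2 * m) + 2 * M + 2 * C) := by
  rcases (norm_nonneg (y - q)).eq_or_lt with h0 | h0
  · rw [← h0, zero_mul, add_zero, sub_eq_zero.1 (norm_eq_zero.1 h0.symm)]
  set σ := ‖y - q‖ with hσ
  have hm := hH.pos
  have hM := hH.pos'
  have key := hH.lagrangian_second_le (a := 1 / (1 + σ)) (b := σ / (1 + σ)) (by positivity)
    (by positivity) (by field_simp) q v ((1 + σ⁻¹) • (y - q)) 0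
  have e₁ : q + (σ / (1 + σ)) • (1 + σ⁻¹) • (y - q) = y := by
    have : σ / (1 + σ) * (1 + σ⁻¹) = 1 := by field_simp; ring
    rw [smul_smul, this]; module
  have e₂ : ‖(1 + σ⁻¹) • (y - q)‖ = 1 + σ := by
    rw [norm_smul, ← hσ, Real.norm_eq_abs, abs_of_pos (by positivity)]
    field_simp; ring
  rw [e₁, e₂] at key
  set z := q - (1 / (1 + σ)) • (1 + σ⁻¹) • (y - q)
  simp only [smul_zero, add_zero, sub_zero, norm_zero] at key
  have key' := mul_le_mul_of_nonneg_left key (by positivity : 0 ≤ 1 + σ)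
  have e₃ : (1 + σ) * (1 / (1 + σ) * lagrangian H y v + σ / (1 + σ) * lagrangian H z v
      - lagrangian H q v) =
      lagrangian H y v + σ * lagrangian H z v - (1 + σ) * lagrangian H q v := by
    field_simp
  have e₄ : (1 + σ) * (1 / (1 + σ) * (σ / (1 + σ)) * (0 ^ 2 / m + C * (1 + σ) ^ 2)) =
      σ * C * (1 + σ) := by field_simp; ring
  rw [e₃, e₄] at key'
  have h1 := hH.lagrangian_le q v
  have h2 := hH.le_lagrangian z v
  have h3 : ‖v‖ ^ 2 / (2 * m) ≤ V ^ 2 / (2 * m) := by gcongr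
  have h4 : 0 ≤ ‖v‖ ^ 2 / (2 * M) := by positivity
  have h5 : σ * (lagrangian H q v - lagrangian H z v) ≤ σ * (V ^ 2 / (2 * m) + 2 * M) :=
    mul_le_mul_of_nonneg_left (by linarith) h0.le
  have h6 : σ * C * (1 + σ) ≤ σ * C * 2 :=
    mul_le_mul_of_nonneg_left (by linarith) (mul_nonneg h0.le hH.nonneg)
  linarith

theorem convexOn (hH : PhaseBounds H m M C) (q : E) : ConvexOn ℝ univ (H q) := by
  have hm := hH.pos
  refine ⟨convex_univ, fun x _ y _ a b ha hb hab => ?_⟩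
  have h := hH.le_second ha hb hab q (a • x + b • y) 0 (x - y)
  have e₁ : a • x + b • y + b • (x - y) = x := by
    obtain rfl : a = 1 - b := by linarith
    module
  have e₂ : a • x + b • y - a • (x - y) = y := by
    obtain rfl : a = 1 - b := by linarith
    module
  simp only [smul_zero, add_zero, sub_zero, norm_zero, e₁, e₂] at h
  have : 0 ≤ a * b * (m / 4 * ‖x - y‖ ^ 2) := by positivity
  simp only [smul_eq_mul]
  nlinarith

theorem exists_velocity [FiniteDimensional ℝ E] (hH : PhaseBounds H m M C) (q p : E) :
    ∃ v, lagrangian H q v ≤ ⟪p, v⟫ - H q p ∧ ‖v‖ ^ 2 ≤ 4 * M ^ 2 * ‖p‖ ^ 2 + 8 * M ^ 2 := by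
  have hM := hH.pos'
  obtain ⟨v, hv⟩ := (hH.convexOn q).exists_subgradient p
  refine ⟨v, lagrangian_le_of_forall fun p' => ?_, ?_⟩
  · have := hv p'
    rw [inner_sub_right, real_inner_comm p' v, real_inner_comm p v] at this
    linarith
  · have h1 := hv (p + (2 * M)⁻¹ • v)
    have h2 := hH.upper q (p + (2 * M)⁻¹ • v)
    have h3 := hH.lower q p
    have h4 : ‖p + (2 * M)⁻¹ • v‖ ^ 2 ≤ 2 * (‖p‖ ^ 2 + ‖(2 * M)⁻¹ • v‖ ^ 2) := by
      have := norm_add_le p ((2 * M)⁻¹ • v)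
      nlinarith [sq_nonneg (‖p‖ - ‖(2 * M)⁻¹ • v‖), norm_nonneg (p + (2 * M)⁻¹ • v)]
    rw [norm_smul, mul_pow, Real.norm_eq_abs, sq_abs] at h4
    rw [add_sub_cancel_left, real_inner_smul_right, real_inner_self_eq_norm_sq] at h1
    have h5 := mul_le_mul_of_nonneg_left h4 (by positivity : 0 ≤ M / 2)
    have h6 : M / 2 * (2 * (‖p‖ ^ 2 + (2 * M)⁻¹ ^ 2 * ‖v‖ ^ 2)) =
      M * ‖p‖ ^ 2 + ‖v‖ ^ 2 / (4 * M) := by field_simp; ring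
    have h7 : (2 * M)⁻¹ * ‖v‖ ^ 2 = 2 * (‖v‖ ^ 2 / (4 * M)) := by field_simp; ring
    have hm := hH.pos
    have h8 : 0 ≤ m / 2 * ‖p‖ ^ 2 := by positivity
    have h9 : ‖v‖ ^ 2 / (4 * M) ≤ M * ‖p‖ ^ 2 + 2 * M := by linarith
    rw [div_le_iff₀ (by positivity)] at h9
    linarith

end PhaseBounds

/-- The action of the uniform motion from `q` to `Q` in time `τ`, with the Lagrangian frozen
at the starting point. -/
noncomputable def stepAction (H : E → E → ℝ) (τ : ℝ) (q Q : E) : ℝ :=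
  τ * lagrangian H q (τ⁻¹ • (Q - q))

namespace PhaseBounds

theorem stepAction_second_le (hH : PhaseBounds H m M C) {τ : ℝ} (hτ : 0 < τ)
    {a b : ℝ} (ha : 0 ≤ a) (hb : 0 ≤ b) (hab : a + b = 1) (q Q h k : E) :
    a * stepAction H τ (q + b • h) (Q + b • k) + b * stepAction H τ (q - a • h) (Q - a • k)
      - stepAction H τ q Q ≤ a * b * (m⁻¹ * (‖k - h‖ ^ 2 / τ) + τ * C * ‖h‖ ^ 2) := by
  have key := mul_le_mul_of_nonneg_left
    (hH.lagrangian_second_le ha hb hab q (τ⁻¹ • (Q - q)) h (τ⁻¹ • (k - h))) hτ.le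
  have e₁ : τ⁻¹ • (Q + b • k - (q + b • h)) = τ⁻¹ • (Q - q) + b • τ⁻¹ • (k - h) := by module
  have e₂ : τ⁻¹ • (Q - a • k - (q - a • h)) = τ⁻¹ • (Q - q) - a • τ⁻¹ • (k - h) := by module
  unfold stepAction
  rw [e₁, e₂]
  rw [norm_smul, mul_pow, Real.norm_eq_abs, sq_abs] at key
  have hm := hH.pos
  have e₃ : τ * (a * b * (τ⁻¹ ^ 2 * ‖k - h‖ ^ 2 / m + C * ‖h‖ ^ 2)) =
    a * b * (m⁻¹ * (‖k - h‖ ^ 2 / τ) + τ * C * ‖h‖ ^ 2) := by field_simp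
  rw [e₃] at key
  linarith

theorem le_stepAction_second (hH : PhaseBounds H m M C) {τ : ℝ} (hτ : 0 < τ)
    {a b : ℝ} (ha : 0 ≤ a) (hb : 0 ≤ b) (hab : a + b = 1) (q Q h k : E) :
    a * b * ((2 * M)⁻¹ * (‖k - h‖ ^ 2 / τ) - τ * (M / 2) * ‖h‖ ^ 2) ≤
    a * stepAction H τ (q + b • h) (Q + b • k) + b * stepAction H τ (q - a • h) (Q - a • k)
      - stepAction H τ q Q := by
  have key := mul_le_mul_of_nonneg_left
    (hH.le_lagrangian_second ha hb hab q (τ⁻¹ • (Q - q)) h (τ⁻¹ • (k - h))) hτ.le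
  have e₁ : τ⁻¹ • (Q + b • k - (q + b • h)) = τ⁻¹ • (Q - q) + b • τ⁻¹ • (k - h) := by module
  have e₂ : τ⁻¹ • (Q - a • k - (q - a • h)) = τ⁻¹ • (Q - q) - a • τ⁻¹ • (k - h) := by module
  unfold stepAction
  rw [e₁, e₂]
  rw [norm_smul, mul_pow, Real.norm_eq_abs, sq_abs] at key
  have hM := hH.pos'
  have e₃ : τ * (a * b * (τ⁻¹ ^ 2 * ‖k - h‖ ^ 2 / (2 * M) - M / 2 * ‖h‖ ^ 2)) =
    a * b * ((2 * M)⁻¹ * (‖k - h‖ ^ 2 / τ) - τ * (M / 2) * ‖h‖ ^ 2) := by field_simp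
  rw [e₃] at key
  linarith

end PhaseBounds

end Lagrangian

section PathInfimum

variable {E : Type*}

/-- Cost of the first `n` steps of a discrete path, with final cost `f` and running cost `B`. -/
def pathCost (f : E → ℝ) (B : E → E → ℝ) (n : ℕ) (γ : ℕ → E) : ℝ :=
  f (γ n) + ∑ i ∈ Finset.range n, B (γ i) (γ (i + 1))

/-- Value function of the `n`-step discrete control problem starting at `x`. -/
noncomputable def pathInf (f : E → ℝ) (B : E → E → ℝ) (n : ℕ) (x : E) : ℝ :=
  ⨅ γ : {γ : ℕ → E // γ 0 = x}, pathCost f B n γ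

variable {f : E → ℝ} {B : E → E → ℝ} {c : ℝ}

theorem le_pathCost_add (hD : ∀ x y, f x ≤ f y + B x y + c) (n : ℕ) (γ : ℕ → E) :
    f (γ 0) ≤ pathCost f B n γ + n * c := by
  induction n with
  | zero => simp [pathCost]
  | succ n ih =>
    have := hD (γ n) (γ (n + 1))
    simp only [pathCost, Finset.sum_range_succ] at ih ⊢
    push_cast
    linarith

theorem pathInf_le (hD : ∀ x y, f x ≤ f y + B x y + c) (n : ℕ) (γ : ℕ → E) :
    pathInf f B n (γ 0) ≤ pathCost f B n γ := by
  refine ciInf_le (f := fun γ' : {γ' : ℕ → E // γ' 0 = γ 0} => pathCost f B n γ')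
    ⟨f (γ 0) - n * c, ?_⟩ ⟨γ, rfl⟩
  rintro _ ⟨⟨γ', h⟩, rfl⟩
  have := le_pathCost_add hD n γ'
  rw [h] at this
  simp only
  linarith

theorem exists_pathCost_lt (f : E → ℝ) (B : E → E → ℝ) (n : ℕ) (x : E) {ε : ℝ} (hε : 0 < ε) :
    ∃ γ : ℕ → E, γ 0 = x ∧ pathCost f B n γ < pathInf f B n x + ε := by
  have : Nonempty {γ : ℕ → E // γ 0 = x} := ⟨⟨fun _ => x, rfl⟩⟩
  obtain ⟨⟨γ, h⟩, hγ⟩ := exists_lt_of_ciInf_lt (lt_add_of_pos_right (pathInf f B n x) hε)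
  exact ⟨γ, h, hγ⟩

theorem pathInf_le_add (hD : ∀ x y, f x ≤ f y + B x y + c) (n : ℕ) (x y : E) :
    pathInf f B n x ≤ pathInf f B n y + B x y + c := by
  refine le_of_forall_pos_le_add fun ε hε => ?_
  obtain ⟨γ, rfl, hγ⟩ := exists_pathCost_lt f B n y hε
  let γ' : ℕ → E := fun i => Nat.casesOn i x γ
  have h1 := pathInf_le hD n γ'
  have h2 : pathCost f B n γ' ≤ pathCost f B n γ + B x (γ 0) + c := by
    cases n with
    | zero => simpa [pathCost, γ'] using hD x (γ 0)
    | succ n =>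
      have := hD (γ n) (γ (n + 1))
      rw [pathCost, Finset.sum_range_succ', pathCost, Finset.sum_range_succ]
      change f (γ n) + (∑ i ∈ Finset.range n, B (γ i) (γ (i + 1)) + B x (γ 0)) ≤ _
      linarith
  change pathInf f B n x ≤ _ at h1
  linarith

end PathInfimum

section PathInfimumEstimates

variable {E : Type*} [NormedAddCommGroup E] [NormedSpace ℝ E] {f : E → ℝ} {B : E → E → ℝ}
  {c c₀ c₁ c₂ τ k : ℝ}

theorem pathInf_second_le (hD : ∀ x y, f x ≤ f y + B x y + c) (hc₂ : 0 ≤ c₂)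
    (hτ : 0 < τ) {a b : ℝ} (ha : 0 ≤ a) (hb : 0 ≤ b) (hab : a + b = 1)
    (hB : ∀ x y h k, a * B (x + b • h) (y + b • k) + b * B (x - a • h) (y - a • k) - B x y ≤
      a * b * (c₁ * (‖k - h‖ ^ 2 / τ) + τ * c₂ * (‖h‖ ^ 2 + ‖k‖ ^ 2)))
    {n : ℕ} (hn : 0 < n) (x d : E) :
    a * pathInf f B n (x + b • d) + b * pathInf f B n (x - a • d) - pathInf f B n x ≤
      a * b * ((c₁ / (n * τ) + 2 * c₂ * (n * τ)) * ‖d‖ ^ 2) := by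
  have hn' : (0 : ℝ) < n := by exact_mod_cast hn
  refine le_of_forall_pos_le_add fun ε hε => ?_
  obtain ⟨γ, rfl, hγ⟩ := exists_pathCost_lt f B n x hε
  let l : ℕ → ℝ := fun i => 1 - i / n
  have hl0 : l 0 = 1 := by simp [l]
  have hln : l n = 0 := by simp [l, hn'.ne']
  have h₁ := pathInf_le hD n fun i => γ i + b • l i • d
  have h₂ := pathInf_le hD n fun i => γ i - a • l i • d
  have hl : ∀ i ≤ n, ‖l i • d‖ ^ 2 ≤ ‖d‖ ^ 2 := fun i hi => by
    have h0 : 0 ≤ l i := by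
      simp only [l, sub_nonneg]; rw [div_le_one hn']; exact_mod_cast hi
    have h1 : l i ≤ 1 := by simp only [l]; linarith [show (0 : ℝ) ≤ i / n by positivity]
    rw [norm_smul, mul_pow, Real.norm_eq_abs, sq_abs]
    exact mul_le_of_le_one_left (by positivity) (pow_le_one₀ h0 h1)
  have hdl : ∀ i, ‖l (i + 1) • d - l i • d‖ ^ 2 = ‖d‖ ^ 2 / n ^ 2 := fun i => by
    rw [← sub_smul, norm_smul, mul_pow, Real.norm_eq_abs, sq_abs]
    simp only [l]; push_cast; field_simp; ring
  have hsum : ∑ i ∈ Finset.range n, (a * B (γ i + b • l i • d) (γ (i + 1) + b • l (i + 1) • d)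
      + b * B (γ i - a • l i • d) (γ (i + 1) - a • l (i + 1) • d) - B (γ i) (γ (i + 1)))
      ≤ ∑ i ∈ Finset.range n, a * b * (c₁ * (‖d‖ ^ 2 / n ^ 2 / τ) + τ * c₂ * (2 * ‖d‖ ^ 2)) := by
    refine Finset.sum_le_sum fun i hi => (hB _ _ _ _).trans ?_
    rw [hdl]
    have hi' := Finset.mem_range.1 hi
    refine mul_le_mul_of_nonneg_left ?_ (mul_nonneg ha hb)
    have := mul_le_mul_of_nonneg_left (add_le_add (hl i hi'.le) (hl (i + 1) hi'))
      (mul_nonneg hτ.le hc₂)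
    linarith
  rw [Finset.sum_const, Finset.card_range, nsmul_eq_mul] at hsum
  rw [Finset.sum_sub_distrib, Finset.sum_add_distrib, ← Finset.mul_sum, ← Finset.mul_sum] at hsum
  have e : n * (a * b * (c₁ * (‖d‖ ^ 2 / n ^ 2 / τ) + τ * c₂ * (2 * ‖d‖ ^ 2))) =
      a * b * ((c₁ / (n * τ) + 2 * c₂ * (n * τ)) * ‖d‖ ^ 2) := by field_simp
  rw [e] at hsum
  simp only [pathCost, hl0, hln, one_smul, zero_smul, smul_zero, add_zero, sub_zero]
    at h₁ h₂ hγ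
  have h₃ := mul_le_mul_of_nonneg_left h₁ ha
  have h₄ := mul_le_mul_of_nonneg_left h₂ hb
  obtain rfl : a = 1 - b := by linarith
  linarith

theorem le_pathInf_second (hD : ∀ x y, f x ≤ f y + B x y + c) (hc₂ : 0 ≤ c₂) (hk : 0 ≤ k)
    (hτ : 0 < τ) {a b : ℝ} (ha : 0 ≤ a) (hb : 0 ≤ b) (hab : a + b = 1)
    (hf : ∀ x d, -(a * b * (k * ‖d‖ ^ 2)) ≤ a * f (x + b • d) + b * f (x - a • d) - f x)
    (hB : ∀ x y h k, a * b * (c₀ * (‖k - h‖ ^ 2 / τ) - τ * c₂ * (‖h‖ ^ 2 + ‖k‖ ^ 2)) ≤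
      a * B (x + b • h) (y + b • k) + b * B (x - a • h) (y - a • k) - B x y)
    {n : ℕ} (hn : 2 * (n * τ) * (k + 2 * c₂ * (n * τ)) ≤ c₀) (x d : E) :
    -(a * b * (2 * (k + 2 * c₂ * (n * τ)) * ‖d‖ ^ 2)) ≤
      a * pathInf f B n (x + b • d) + b * pathInf f B n (x - a • d) - pathInf f B n x := by
  refine le_of_forall_pos_le_add fun ε hε => ?_
  obtain ⟨γ₁, hγ₁0, hγ₁⟩ := exists_pathCost_lt f B n (x + b • d) hε
  obtain ⟨γ₂, hγ₂0, hγ₂⟩ := exists_pathCost_lt f B n (x - a • d) hε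
  let γ : ℕ → E := fun i => a • γ₁ i + b • γ₂ i
  let η : ℕ → E := fun i => γ₁ i - γ₂ i
  have hγ0 : γ 0 = x := by
    simp only [γ, hγ₁0, hγ₂0]
    obtain rfl : a = 1 - b := by linarith
    module
  have hη0 : η 0 = d := by
    simp only [η, hγ₁0, hγ₂0]
    obtain rfl : a = 1 - b := by linarith
    module
  have e₁ : ∀ i, γ i + b • η i = γ₁ i := fun i => by
    simp only [γ, η]
    obtain rfl : a = 1 - b := by linarith
    module
  have e₂ : ∀ i, γ i - a • η i = γ₂ i := fun i => by
    simp only [γ, η]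
    obtain rfl : b = 1 - a := by linarith
    module
  set S := ∑ i ∈ Finset.range n, ‖η (i + 1) - η i‖ ^ 2 with hS
  have hS0 : 0 ≤ S := Finset.sum_nonneg fun _ _ => by positivity
  have hη : ∀ i ≤ n, ‖η i‖ ^ 2 ≤ 2 * ‖d‖ ^ 2 + 2 * (n * S) := fun i hi => by
    have h1 : ‖η i - η 0‖ ≤ ∑ j ∈ Finset.range n, ‖η (j + 1) - η j‖ := by
      rw [← Finset.sum_range_sub]
      refine (norm_sum_le _ _).trans ?_
      exact Finset.sum_le_sum_of_subset_of_nonneg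
        (Finset.range_subset_range.2 hi) fun _ _ _ => norm_nonneg _
    have h2 : (∑ j ∈ Finset.range n, ‖η (j + 1) - η j‖) ^ 2 ≤ n * S := by
      simpa using sq_sum_le_card_mul_sum_sq (s := Finset.range n)
        (f := fun j => ‖η (j + 1) - η j‖)
    have h3 : ‖η i‖ ≤ ‖d‖ + ‖η i - η 0‖ := by
      rw [← hη0]
      simpa using norm_add_le (η 0) (η i - η 0)
    have h4 : ‖η i - η 0‖ ^ 2 ≤ n * S := (pow_le_pow_left₀ (norm_nonneg _) h1 2).trans h2
    nlinarith [sq_nonneg (‖d‖ - ‖η i - η 0‖), norm_nonneg (η i)]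
  set R := 2 * ‖d‖ ^ 2 + 2 * (n * S) with hR
  have hsum : ∑ i ∈ Finset.range n,
      a * b * (c₀ * (‖η (i + 1) - η i‖ ^ 2 / τ) - τ * c₂ * (2 * R)) ≤
      ∑ i ∈ Finset.range n, (a * B (γ₁ i) (γ₁ (i + 1)) + b * B (γ₂ i) (γ₂ (i + 1))
        - B (γ i) (γ (i + 1))) := by
    refine Finset.sum_le_sum fun i hi => ?_
    have hi' := Finset.mem_range.1 hi
    have h := hB (γ i) (γ (i + 1)) (η i) (η (i + 1))
    rw [e₁, e₁, e₂, e₂] at h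
    refine le_trans (mul_le_mul_of_nonneg_left ?_ (mul_nonneg ha hb)) h
    have := mul_le_mul_of_nonneg_left (add_le_add (hη i hi'.le) (hη (i + 1) hi'))
      (mul_nonneg hτ.le hc₂)
    linarith
  rw [Finset.sum_sub_distrib, Finset.sum_add_distrib, ← Finset.mul_sum, ← Finset.mul_sum,
    ← Finset.mul_sum, Finset.sum_sub_distrib, ← Finset.mul_sum, ← Finset.sum_div, ← hS,
    Finset.sum_const, Finset.card_range, nsmul_eq_mul] at hsum
  have hfin := hf (γ n) (η n)
  rw [e₁, e₂] at hfin
  have h₁ := pathInf_le hD n γ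
  rw [hγ0] at h₁
  simp only [pathCost] at h₁ hγ₁ hγ₂
  have h₇ := mul_le_mul_of_nonneg_left hγ₁.le ha
  have h₈ := mul_le_mul_of_nonneg_left hγ₂.le hb
  have h10 : a * ε + b * ε = ε := by rw [← add_mul, hab, one_mul]
  have hkR : -(2 * (k + 2 * c₂ * (n * τ)) * ‖d‖ ^ 2) ≤
      -(k * ‖η n‖ ^ 2) + (c₀ * (S / τ) - n * (τ * c₂ * (2 * R))) := by
    have i1 := mul_le_mul_of_nonneg_left (hη n le_rfl) hk
    have i2 := mul_le_mul_of_nonneg_right hn (div_nonneg hS0 hτ.le)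
    have i3 : 2 * (n * τ) * (k + 2 * c₂ * (n * τ)) * (S / τ) =
      2 * (n * S) * (k + 2 * c₂ * (n * τ)) := by field_simp
    rw [i3] at i2
    have i4 : (k + 2 * c₂ * (n * τ)) * R = 2 * (k + 2 * c₂ * (n * τ)) * ‖d‖ ^ 2 +
      2 * (n * S) * (k + 2 * c₂ * (n * τ)) := by rw [hR]; ring
    linarith
  have h11 := mul_le_mul_of_nonneg_left hkR (mul_nonneg ha hb)
  linarith

end PathInfimumEstimates

section Subsolution

open MeasureTheory

variable {E : Type*} [NormedAddCommGroup E] [InnerProductSpace ℝ E] [FiniteDimensional ℝ E]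

theorem sub_le_of_inner_gradient_le [MeasurableSpace E] [BorelSpace E] {u : E → ℝ} {K : ℝ≥0}
    (hu : LipschitzWith K u) {q v : E} {T r ℓ : ℝ} (hT : 0 ≤ T) (hr : 0 < r)
    (h : ∀ s ∈ Icc 0 T, ∀ z, ‖z‖ < r → DifferentiableAt ℝ u (q + z + s • v) →
      ⟪gradient u (q + z + s • v), v⟫ ≤ ℓ) :
    u (q + T • v) - u q ≤ T * ℓ := by
  have hmeas : MeasurableSet {x : ℝ × E | DifferentiableAt ℝ u (q + x.2 + x.1 • v)} :=
    (measurableSet_of_differentiableAt ℝ u).preimage (by fun_prop)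
  have hae : ∀ᵐ s : ℝ, ∀ᵐ z : E, DifferentiableAt ℝ u (q + z + s • v) := by
    refine Filter.Eventually.of_forall fun s => ?_
    have h1 := (measurePreserving_add_left (volume : Measure E) (q + s • v)).quasiMeasurePreserving.ae
      (hu.ae_differentiableAt (μ := volume))
    filter_upwards [h1] with z hz
    rwa [show q + z + s • v = q + s • v + z by abel]
  have hae' : ∀ᵐ z : E, ∀ᵐ s : ℝ, DifferentiableAt ℝ u (q + z + s • v) :=
    (Measure.ae_ae_comm hmeas).1 hae
  have hgood : ∀ z, ‖z‖ < r → (∀ᵐ s : ℝ, DifferentiableAt ℝ u (q + z + s • v)) →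
      u (q + z + T • v) - u (q + z) ≤ T * ℓ := fun z hz hzs => by
    set g : ℝ → ℝ := fun s => u (q + z + s • v) with hg
    have hline : LipschitzWith ‖v‖₊ fun s : ℝ => q + z + s • v :=
      LipschitzWith.of_dist_le_mul fun s t => by
        rw [dist_add_left, dist_eq_norm, ← sub_smul, norm_smul, dist_eq_norm, mul_comm]
        rfl
    have hgL : AbsolutelyContinuousOnInterval g 0 T :=
      ((hu.comp hline).lipschitzOnWith).absolutelyContinuousOnInterval
    have hFTC := hgL.integral_deriv_eq_sub
    have hle : ∫ s in (0 : ℝ)..T, deriv g s ≤ ∫ _ in (0 : ℝ)..T, ℓ := by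
      refine intervalIntegral.integral_mono_ae_restrict hT hgL.intervalIntegrable_deriv
        intervalIntegrable_const ?_
      rw [Filter.EventuallyLE, ae_restrict_iff' measurableSet_Icc]
      filter_upwards [hzs] with s hs hsT
      have hd : HasDerivAt (fun s : ℝ => q + z + s • v) v s := by
        simpa using ((hasDerivAt_id s).smul_const v).const_add (q + z)
      have h2 := (hs.hasGradientAt.hasFDerivAt.comp_hasDerivAt s hd).deriv
      have h3 : deriv g s = ⟪gradient u (q + z + s • v), v⟫ := by
        rw [← InnerProductSpace.toDual_apply_apply (𝕜 := ℝ)]; exact h2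
      rw [h3]
      exact h s hsT z hz hs
    rw [hFTC, intervalIntegral.integral_const] at hle
    simpa [hg] using hle
  by_contra! hcon
  have hopen : IsOpen {z : E | ‖z‖ < r ∧ T * ℓ < u (q + z + T • v) - u (q + z)} := by
    have := hu.continuous
    have h1 : Continuous fun z => u (q + z + T • v) - u (q + z) := by fun_prop
    exact (isOpen_lt continuous_norm continuous_const).inter (isOpen_lt continuous_const h1)
  obtain ⟨z, ⟨hz, hlt⟩, hzs⟩ := (Measure.dense_of_ae hae').inter_open_nonempty _ hopen
    ⟨0, by simpa using ⟨hr, hcon⟩⟩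
  exact absurd (hgood z hz hzs) hlt.not_ge

namespace PhaseBounds

variable {H : E → E → ℝ} {m M C : ℝ}

theorem exists_forall_le_stepAction [MeasurableSpace E] [BorelSpace E]
    (hH : PhaseBounds H m M C) {u : E → ℝ} {K : ℝ≥0}
    (hu : LipschitzWith K u) {α : ℝ}
    (hsub : ∀ x, DifferentiableAt ℝ u x → H x (gradient u x) ≤ α) {ε : ℝ} (hε : 0 < ε) :
    ∃ τ₀ > 0, ∀ τ, 0 < τ → τ < τ₀ → ∀ q Q,
      u Q ≤ u q + stepAction H τ q Q + τ * (α + ε) := by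
  have hm := hH.pos
  have hM := hH.pos'
  have hC := hH.nonneg
  set V : ℝ := 2 * M * (K + M + |α|) + 1 with hV
  have hV0 : 0 < V := by positivity
  set G : ℝ := V ^ 2 / (2 * m) + 2 * M + 2 * C with hG
  have hG0 : 0 < G := by positivity
  set ρ : ℝ := min 1 (ε / G) with hρ
  have hρ0 : 0 < ρ := lt_min one_pos (by positivity)
  refine ⟨ρ / (2 * V), by positivity, fun τ hτ hτ₀ q Q => ?_⟩
  rw [lt_div_iff₀ (by positivity)] at hτ₀
  obtain ⟨v, hv⟩ : ∃ v, v = τ⁻¹ • (Q - q) := ⟨_, rfl⟩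
  have hQ : Q = q + τ • v := by
    rw [hv, smul_smul, mul_inv_cancel₀ hτ.ne']; module
  rw [stepAction, ← hv, hQ]
  rcases le_or_gt ‖v‖ V with hvV | hvV
  · have := sub_le_of_inner_gradient_le hu (q := q) (v := v) (T := τ) (r := ρ / 2)
      (ℓ := lagrangian H q v + (α + ε)) hτ.le (by positivity) fun s hs z hz hd => by
        set y := q + z + s • v with hy
        have hyq : ‖y - q‖ ≤ ρ := by
          have e : y - q = z + s • v := by rw [hy]; abel
          have h1 := norm_add_le z (s • v)
          rw [norm_smul, Real.norm_eq_abs, abs_of_nonneg hs.1] at h1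
          have h2 : s * ‖v‖ ≤ τ * V := mul_le_mul hs.2 hvV (norm_nonneg _) hτ.le
          rw [e]; linarith
        have h1 := hH.fenchel y (gradient u y) v
        have h2 := hH.lagrangian_le_add hvV (hyq.trans (min_le_left _ _))
        have h3 : ‖y - q‖ * G ≤ ε := (le_div_iff₀ hG0).1 (hyq.trans (min_le_right _ _))
        linarith [hsub y hd]
    linarith
  · have h1 := (le_abs_self _).trans (hu.dist_le_mul (q + τ • v) q)
    rw [dist_self_add_left, norm_smul, Real.norm_eq_abs, abs_of_pos hτ] at h1
    have h2 := hH.le_lagrangian q v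
    have h3 : ‖v‖ * (K + M + |α|) ≤ ‖v‖ ^ 2 / (2 * M) := by
      rw [le_div_iff₀ (by positivity)]
      have : 2 * M * (K + M + |α|) ≤ ‖v‖ := by linarith
      nlinarith [norm_nonneg v]
    have h4 : 1 ≤ ‖v‖ := by
      have : 0 ≤ 2 * M * (K + M + |α|) := by positivity
      linarith
    have h5 : M + |α| ≤ ‖v‖ * (M + |α|) := le_mul_of_one_le_left (by positivity) h4
    have h6 : K * ‖v‖ ≤ lagrangian H q v + (α + ε) := by linarith [neg_abs_le α]
    have h7 := mul_le_mul_of_nonneg_left h6 hτ.le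
    linarith

end PhaseBounds

end Subsolution

section Regularity

variable {E : Type*} [NormedAddCommGroup E] [InnerProductSpace ℝ E]

theorem exists_quadratic_tangent [FiniteDimensional ℝ E] {w : E → ℝ} {K : ℝ}
    (hle : ∀ {a b : ℝ}, 0 ≤ a → 0 ≤ b → a + b = 1 → ∀ x d,
      a * w (x + b • d) + b * w (x - a • d) - w x ≤ a * b * (K * ‖d‖ ^ 2))
    (hge : ∀ {a b : ℝ}, 0 ≤ a → 0 ≤ b → a + b = 1 → ∀ x d,
      -(a * b * (K * ‖d‖ ^ 2)) ≤ a * w (x + b • d) + b * w (x - a • d) - w x) (x : E) :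
    ∃ g : E, ∀ y, |w y - w x - ⟪g, y - x⟫| ≤ K * ‖y - x‖ ^ 2 := by
  have hnorm : ∀ {a b : ℝ}, a + b = 1 → ∀ y z : E,
      ‖a • y + b • z‖ ^ 2 = a * ‖y‖ ^ 2 + b * ‖z‖ ^ 2 - a * b * ‖y - z‖ ^ 2 := fun {a b} hab y z => by
    rw [norm_add_sq_real, norm_sub_sq_real, norm_smul, norm_smul, mul_pow, mul_pow,
      Real.norm_eq_abs, Real.norm_eq_abs, sq_abs, sq_abs, real_inner_smul_left,
      real_inner_smul_right]
    obtain rfl : a = 1 - b := by linarith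
    ring
  have hmid : ∀ {a b : ℝ}, a + b = 1 → ∀ y z : E,
      a • y + b • z + b • (y - z) = y ∧ a • y + b • z - a • (y - z) = z := fun {a b} hab y z => by
    obtain rfl : a = 1 - b := by linarith
    constructor <;> module
  have hφ : ConvexOn ℝ univ fun x => w x + K * ‖x‖ ^ 2 := by
    refine ⟨convex_univ, fun y _ z _ a b ha hb hab => ?_⟩
    have h := hge ha hb hab (a • y + b • z) (y - z)
    rw [(hmid hab y z).1, (hmid hab y z).2] at h
    simp only [hnorm hab, smul_eq_mul]
    linarith
  have hψ : ConvexOn ℝ univ fun x => K * ‖x‖ ^ 2 - w x := by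
    refine ⟨convex_univ, fun y _ z _ a b ha hb hab => ?_⟩
    have h := hle ha hb hab (a • y + b • z) (y - z)
    rw [(hmid hab y z).1, (hmid hab y z).2] at h
    simp only [hnorm hab, smul_eq_mul]
    linarith
  obtain ⟨p, hp⟩ := hφ.exists_subgradient x
  obtain ⟨r, hr⟩ := hψ.exists_subgradient x
  have hexp : ∀ y, ‖y‖ ^ 2 = ‖x‖ ^ 2 + 2 * ⟪x, y - x⟫ + ‖y - x‖ ^ 2 := fun y => by
    rw [← norm_add_sq_real, add_sub_cancel]
  have hsum : p + r = (4 * K) • x := by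
    rw [← sub_eq_zero, ← norm_eq_zero]
    have hlin : ∀ z, ⟪p + r - (4 * K) • x, z⟫ = ⟪p, z⟫ + ⟪r, z⟫ - 4 * K * ⟪x, z⟫ := fun z => by
      rw [inner_sub_left, inner_add_left, real_inner_smul_left]
    set e := p + r - (4 * K) • x with he
    have hquad : ∀ t : ℝ, t * ‖e‖ ^ 2 ≤ 2 * K * t ^ 2 * ‖e‖ ^ 2 := fun t => by
      have h1 := hp (x + t • e)
      have h2 := hr (x + t • e)
      have h3 := hexp (x + t • e)
      rw [add_sub_cancel_left] at h1 h2 h3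
      rw [h3] at h1 h2
      rw [norm_smul, mul_pow, Real.norm_eq_abs, sq_abs] at h1 h2
      have h4 : ⟪p, t • e⟫ + ⟪r, t • e⟫ - 4 * K * ⟪x, t • e⟫ = t * ‖e‖ ^ 2 := by
        rw [← hlin, real_inner_smul_right, real_inner_self_eq_norm_sq]
      linarith
    have h1 := hquad (1 / (4 * |K| + 1))
    have h2 : 2 * K * (1 / (4 * |K| + 1)) ^ 2 ≤ 1 / 2 * (1 / (4 * |K| + 1)) := by
      rw [show 2 * K * (1 / (4 * |K| + 1)) ^ 2 =
        (2 * K / (4 * |K| + 1)) * (1 / (4 * |K| + 1)) by ring]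
      refine mul_le_mul_of_nonneg_right ?_ (by positivity)
      rw [div_le_iff₀ (by positivity)]
      linarith [le_abs_self K]
    have h3 : 0 < 1 / (4 * |K| + 1) := by positivity
    have h4 := mul_le_mul_of_nonneg_right h2 (sq_nonneg ‖e‖)
    have h5 : ‖e‖ ^ 2 ≤ 0 := by
      by_contra! hpos
      nlinarith [mul_pos h3 hpos]
    exact pow_eq_zero_iff two_ne_zero |>.1 (le_antisymm h5 (sq_nonneg _))
  refine ⟨p - (2 * K) • x, fun y => ?_⟩
  have h1 := hp y
  have h2 := hr y
  have h3 := hexp y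
  have e : r = (4 * K) • x - p := by rw [← hsum]; abel
  rw [e, inner_sub_left, real_inner_smul_left] at h2
  rw [inner_sub_left, real_inner_smul_left, abs_le]
  rw [h3] at h1 h2
  constructor <;> linarith

theorem norm_sub_le_of_quadratic_tangent {w : E → ℝ} {g : E → E} {K : ℝ} (hK : 0 < K)
    (h : ∀ x y, |w y - w x - ⟪g x, y - x⟫| ≤ K * ‖y - x‖ ^ 2) (x y : E) :
    ‖g x - g y‖ ≤ 6 * K * ‖x - y‖ := by
  set e := g x - g y with he
  set z := (6 * K)⁻¹ • e with hz
  have h1 := (abs_le.1 (h x (y - z))).2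
  have h2 := (abs_le.1 (h y (y - z))).1
  have h3 := (abs_le.1 (h x y)).1
  have e1 : y - z - x = (y - x) - z := by abel
  have e2 : y - z - y = -z := by abel
  rw [e1, inner_sub_right] at h1
  rw [e2, inner_neg_right, norm_neg] at h2
  have h4 : ⟪g x, z⟫ - ⟪g y, z⟫ = (6 * K)⁻¹ * ‖e‖ ^ 2 := by
    rw [← inner_sub_left, hz, real_inner_smul_right, real_inner_self_eq_norm_sq]
  have h5 : ‖z‖ ^ 2 = (6 * K)⁻¹ ^ 2 * ‖e‖ ^ 2 := by
    rw [hz, norm_smul, mul_pow, Real.norm_eq_abs, sq_abs]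
  have h6 : ‖(y - x) - z‖ ^ 2 ≤ 2 * (‖y - x‖ ^ 2 + ‖z‖ ^ 2) := by
    have := norm_sub_le (y - x) z
    nlinarith [sq_nonneg (‖y - x‖ - ‖z‖), norm_nonneg (y - x - z)]
  have h7 : K * ‖z‖ ^ 2 = (6 * K)⁻¹ * ‖e‖ ^ 2 / 6 := by
    rw [h5]
    field_simp
  have h8 := mul_le_mul_of_nonneg_left h6 hK.le
  have h9 : (6 * K)⁻¹ * ‖e‖ ^ 2 ≤ 6 * K * ‖y - x‖ ^ 2 := by linarith
  rw [inv_mul_le_iff₀ (by positivity)] at h9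
  rw [norm_sub_rev x y]
  exact le_of_sq_le_sq (h9.trans_eq (by ring)) (by positivity)

theorem hasGradientAt_of_quadratic_tangent [CompleteSpace E] {w : E → ℝ} {g : E} {K : ℝ} {x : E}
    (h : ∀ y, |w y - w x - ⟪g, y - x⟫| ≤ K * ‖y - x‖ ^ 2) : HasGradientAt w g x := by
  rw [hasGradientAt_iff_isLittleO]
  refine Asymptotics.IsBigO.trans_isLittleO (g := fun y => ‖y - x‖ ^ 2)
    (Asymptotics.IsBigO.of_bound K (Filter.Eventually.of_forall fun y => ?_))
    (Asymptotics.isLittleO_pow_sub_sub x one_lt_two)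
  rw [Real.norm_eq_abs, Real.norm_eq_abs, abs_of_nonneg (sq_nonneg ‖y - x‖)]
  exact h y

/-- A family of functions with uniform quadratic tangents, uniformly bounded gradients and
normalised at the origin has a pointwise limit together with its gradients. -/
theorem exists_limit_quadratic_tangent [FiniteDimensional ℝ E] {w : ℕ → E → ℝ} {g : ℕ → E → E}
    {K R : ℝ} (h0 : ∀ j, w j 0 = 0) (hR : ∀ j x, ‖g j x‖ ≤ R)
    (h : ∀ j x y, |w j y - w j x - ⟪g j x, y - x⟫| ≤ K * ‖y - x‖ ^ 2) :
    ∃ (W : E → ℝ) (G : E → E), (∀ x y, |W y - W x - ⟪G x, y - x⟫| ≤ K * ‖y - x‖ ^ 2) ∧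
      ∀ x, Filter.Tendsto (fun j => g j x) (Filter.hyperfilter ℕ) (nhds (G x)) := by
  have : ProperSpace E := FiniteDimensional.proper ℝ E
  have hG : ∀ x, ∃ G, Filter.Tendsto (fun j => g j x) (Filter.hyperfilter ℕ) (nhds G) := fun x => by
    obtain ⟨G, -, hG⟩ := (isCompact_closedBall (0 : E) R).ultrafilter_le_nhds
      ((Filter.hyperfilter ℕ).map fun j => g j x)
      (Filter.tendsto_principal.2 (Filter.Eventually.of_forall fun j => by simpa using hR j x))
    exact ⟨G, hG⟩
  have hW : ∀ x, ∃ W, Filter.Tendsto (fun j => w j x) (Filter.hyperfilter ℕ) (nhds W) := fun x => by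
    obtain ⟨W, -, hW⟩ := (isCompact_closedBall (0 : ℝ) (R * ‖x‖ + K * ‖x‖ ^ 2)).ultrafilter_le_nhds
      ((Filter.hyperfilter ℕ).map fun j => w j x)
      (Filter.tendsto_principal.2 (Filter.Eventually.of_forall fun j => by
        have h1 := h j 0 x
        rw [h0, sub_zero, sub_zero] at h1
        have h2 := (abs_real_inner_le_norm (g j 0) x).trans
          (mul_le_mul_of_nonneg_right (hR j 0) (norm_nonneg x))
        rw [mem_closedBall_zero_iff, Real.norm_eq_abs]
        have h3 := abs_add_le (w j x - ⟪g j 0, x⟫) ⟪g j 0, x⟫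
        rw [sub_add_cancel] at h3
        linarith))
    exact ⟨W, hW⟩
  choose G hG using hG
  choose W hW using hW
  exact ⟨W, G, fun x y => le_of_tendsto' ((((hW y).sub (hW x)).sub
    ((hG x).inner tendsto_const_nhds)).abs) fun j => h j x y, hG⟩

end Regularity

section Critical

variable {E : Type*} [NormedAddCommGroup E] [InnerProductSpace ℝ E] [FiniteDimensional ℝ E]
  {H : E → E → ℝ} {m M C : ℝ}

namespace PhaseBounds

/-- Regularisation of a function satisfying the discrete sub-solution inequality by a forward
followed by a short backward discrete Lax–Oleinik evolution. -/
theorem exists_regularization (hH : PhaseBounds H m M C) :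
    ∃ (l : ℕ) (K : ℝ), 0 < l ∧ 0 < K ∧ ∀ (N : ℕ), 0 < N → ∀ (c : ℝ) (u : E → ℝ),
      (∀ q Q, u Q ≤ u q + stepAction H (1 / (l * N)) q Q + c) →
      ∃ (w : E → ℝ) (g : E → E),
        (∀ q Q, w Q ≤ w q + stepAction H (1 / (l * N)) q Q + c) ∧
        ∀ x y, |w y - w x - ⟪g x, y - x⟫| ≤ K * ‖y - x‖ ^ 2 := by
  have hm := hH.pos
  have hM := hH.pos'
  have hC := hH.nonneg
  set k : ℝ := m⁻¹ + 2 * C with hk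
  have hk0 : 0 < k := by positivity
  obtain ⟨l, hl⟩ := exists_nat_gt (4 * M * (k + M))
  have hl0' : (0 : ℝ) < l := lt_trans (by positivity) hl
  have hl0 : 0 < l := by exact_mod_cast hl0'
  have hl1 : (1 : ℝ) ≤ l := by exact_mod_cast hl0
  refine ⟨l, 2 * (k + M) + m⁻¹ * l + 2 * C, hl0, by positivity, fun N hN c u hu => ?_⟩
  have hN' : (0 : ℝ) < N := by exact_mod_cast hN
  set τ : ℝ := 1 / (l * N) with hτ
  have hτ0 : 0 < τ := by positivity
  have hlN : ((l * N : ℕ) : ℝ) * τ = 1 := by rw [hτ]; push_cast; field_simp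
  have hNτ : (N : ℝ) * τ = 1 / l := by rw [hτ]; field_simp
  have hl' : 1 / (l : ℝ) ≤ 1 := by rw [div_le_one hl0']; exact hl1
  set U := pathInf u (fun x y => stepAction H τ y x) (l * N) with hU
  have hUD : ∀ x y, U x ≤ U y + stepAction H τ y x + c :=
    pathInf_le_add (fun x y => hu y x) (l * N)
  have hUsc : ∀ {a b : ℝ}, 0 ≤ a → 0 ≤ b → a + b = 1 → ∀ x d,
      a * U (x + b • d) + b * U (x - a • d) - U x ≤ a * b * (k * ‖d‖ ^ 2) :=
    fun {a b} ha hb hab x d => by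
      have := pathInf_second_le (c₁ := m⁻¹) (c₂ := C) (fun x y => hu y x) hC hτ0 ha hb hab
        (fun x y h k => (hH.stepAction_second_le hτ0 ha hb hab y x k h).trans ?_)
        (Nat.mul_pos hl0 hN) x d
      · rw [hlN, div_one, mul_one] at this
        exact this
      · refine mul_le_mul_of_nonneg_left ?_ (mul_nonneg ha hb)
        rw [norm_sub_rev h k]
        have : 0 ≤ τ * C * ‖h‖ ^ 2 := by positivity
        linarith
  have hVD : ∀ x y, -U x ≤ -U y + stepAction H τ x y + c := fun x y => by linarith [hUD y x]
  set V := pathInf (fun x => -U x) (stepAction H τ) N with hV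
  have hD : ∀ x y, V x ≤ V y + stepAction H τ x y + c := pathInf_le_add hVD N
  have hVle : ∀ {a b : ℝ}, 0 ≤ a → 0 ≤ b → a + b = 1 → ∀ x d,
      a * V (x + b • d) + b * V (x - a • d) - V x ≤
        a * b * ((2 * (k + M) + m⁻¹ * l + 2 * C) * ‖d‖ ^ 2) := fun {a b} ha hb hab x d => by
    refine (pathInf_second_le (c₁ := m⁻¹) (c₂ := C) hVD hC hτ0 ha hb hab
        (fun x y h k => (hH.stepAction_second_le hτ0 ha hb hab x y h k).trans ?_) hN x d).trans ?_
    · refine mul_le_mul_of_nonneg_left ?_ (mul_nonneg ha hb)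
      have : 0 ≤ τ * C * ‖k‖ ^ 2 := by positivity
      linarith
    · refine mul_le_mul_of_nonneg_left (mul_le_mul_of_nonneg_right ?_ (sq_nonneg _))
        (mul_nonneg ha hb)
      rw [hNτ]
      have h1 : 2 * C * (1 / l) ≤ 2 * C * 1 := mul_le_mul_of_nonneg_left hl' (by positivity)
      have h2 : m⁻¹ / (1 / (l : ℝ)) = m⁻¹ * l := by field_simp
      rw [h2]
      linarith
  have hVge : ∀ {a b : ℝ}, 0 ≤ a → 0 ≤ b → a + b = 1 → ∀ x d,
      -(a * b * ((2 * (k + M) + m⁻¹ * l + 2 * C) * ‖d‖ ^ 2)) ≤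
        a * V (x + b • d) + b * V (x - a • d) - V x := fun {a b} ha hb hab x d => by
    have hs : 2 * (M / 2) * (1 / (l : ℝ)) ≤ M := by
      have := mul_le_mul_of_nonneg_left hl' hM.le
      linarith
    refine le_trans ?_ (le_pathInf_second (c₀ := (2 * M)⁻¹) (c₂ := M / 2) (k := k) hVD
      (by positivity) hk0.le hτ0 ha hb hab (fun x d => by linarith [hUsc ha hb hab x d])
      (fun x y h k => le_trans ?_ (hH.le_stepAction_second hτ0 ha hb hab x y h k)) ?_ x d)
    · rw [hNτ, neg_le_neg_iff]
      refine mul_le_mul_of_nonneg_left (mul_le_mul_of_nonneg_right ?_ (sq_nonneg _))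
        (mul_nonneg ha hb)
      have : 0 ≤ m⁻¹ * l := by positivity
      linarith
    · refine mul_le_mul_of_nonneg_left ?_ (mul_nonneg ha hb)
      have : 0 ≤ τ * (M / 2) * ‖k‖ ^ 2 := by positivity
      linarith
    · rw [hNτ]
      have h1 : 2 * (1 / (l : ℝ)) * (k + 2 * (M / 2) * (1 / l)) ≤ 2 * (1 / l) * (k + M) :=
        mul_le_mul_of_nonneg_left (by linarith) (by positivity)
      refine h1.trans ?_
      rw [inv_eq_one_div, le_div_iff₀ (by positivity)]
      field_simp
      linarith
  choose g hg using exists_quadratic_tangent hVle hVge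
  refine ⟨fun x => -V x, fun x => -g x, fun q Q => by linarith [hD q Q], fun x y => ?_⟩
  rw [← abs_neg, inner_neg_left]
  convert! hg x y using 2
  ring

theorem le_of_discrete_subsolution (hH : PhaseBounds H m M C) {τ K c : ℝ} (hτ : 0 < τ)
    (hK : 0 ≤ K) {w : E → ℝ} {x p : E} (hw : ∀ Q, w Q ≤ w x + stepAction H τ x Q + τ * c)
    (hp : ∀ y, |w y - w x - ⟪p, y - x⟫| ≤ K * ‖y - x‖ ^ 2) :
    H x p ≤ c + K * τ * (4 * M ^ 2 * ‖p‖ ^ 2 + 8 * M ^ 2) := by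
  obtain ⟨v, hv, hvn⟩ := hH.exists_velocity x p
  have h1 := hw (x + τ • v)
  have h2 := (abs_le.1 (hp (x + τ • v))).1
  rw [stepAction, add_sub_cancel_left, smul_smul, inv_mul_cancel₀ hτ.ne', one_smul] at h1
  rw [add_sub_cancel_left, real_inner_smul_right, norm_smul, mul_pow, Real.norm_eq_abs,
    sq_abs] at h2
  have h3 := mul_le_mul_of_nonneg_left hv hτ.le
  have h4 := mul_le_mul_of_nonneg_left hvn (mul_nonneg hK hτ.le)
  have h5 : τ * H x p ≤ τ * (c + K * τ * ‖v‖ ^ 2) := by nlinarith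
  linarith [le_of_mul_le_mul_left h5 hτ]

theorem exists_uniform_regularization [MeasurableSpace E] [BorelSpace E]
    (hH : PhaseBounds H m M C) (β : ℝ) :
    ∃ K R : ℝ, 0 < K ∧ ∀ α ≤ β, ∀ u : E → ℝ, (∃ L : ℝ≥0, LipschitzWith L u) →
      (∀ x, DifferentiableAt ℝ u x → H x (gradient u x) ≤ α) → ∀ ε, 0 < ε → ε ≤ 1 →
      ∃ (w : E → ℝ) (g : E → E), w 0 = 0 ∧ (∀ x, ‖g x‖ ≤ R) ∧
        (∀ x y, |w y - w x - ⟪g x, y - x⟫| ≤ K * ‖y - x‖ ^ 2) ∧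
        ∀ x, H x (g x) ≤ α + 2 * ε := by
  have hm := hH.pos
  have hM := hH.pos'
  obtain ⟨l, K, hl, hK, hreg⟩ := hH.exists_regularization
  set R : ℝ := 4 / m * (β + 1 + M + m / 2) with hR
  refine ⟨K, R + 1, hK, fun α hα u ⟨L, hL⟩ hsub ε hε hε1 => ?_⟩
  obtain ⟨τ₀, hτ₀, hdisc⟩ := hH.exists_forall_le_stepAction hL hsub hε
  set D : ℝ := 4 * M ^ 2 * |R| + 8 * M ^ 2 with hD
  have hD0 : 0 < D := by positivity
  obtain ⟨N, hN⟩ := exists_nat_one_div_lt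
    (lt_min hτ₀ (lt_min (by positivity : 0 < m / (16 * M ^ 2 * K))
      (by positivity : 0 < ε / (K * D))))
  have hl1 : (1 : ℝ) ≤ l := by exact_mod_cast hl
  set τ : ℝ := 1 / (l * (N + 1 : ℕ)) with hτ
  have hτ0 : 0 < τ := by positivity
  have hτN : τ ≤ 1 / ((N : ℝ) + 1) := by
    rw [hτ]; push_cast
    refine one_div_le_one_div_of_le (by positivity) ?_
    exact le_mul_of_one_le_left (by positivity) hl1
  have hτlt := lt_min_iff.1 (hτN.trans_lt hN)
  have hτ2 := lt_min_iff.1 hτlt.2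
  obtain ⟨w, g, hw, hg⟩ := hreg (N + 1) N.succ_pos (τ * (α + ε)) u
    (hdisc τ hτ0 hτlt.1)
  have h1 : ∀ x, H x (g x) ≤ α + ε + K * τ * (4 * M ^ 2 * ‖g x‖ ^ 2 + 8 * M ^ 2) := fun x =>
    hH.le_of_discrete_subsolution hτ0 hK.le (hw x) (hg x)
  have h2 : K * τ * (4 * M ^ 2) ≤ m / 4 := by
    have := hτ2.1
    rw [lt_div_iff₀ (by positivity)] at this
    linarith
  have h3 : K * τ * D ≤ ε := by
    have := hτ2.2
    rw [lt_div_iff₀ (by positivity)] at this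
    linarith
  have h4 : ∀ x, ‖g x‖ ^ 2 ≤ R := fun x => by
    have i1 := h1 x
    have i2 := hH.lower x (g x)
    have i3 := mul_le_mul_of_nonneg_right h2 (sq_nonneg ‖g x‖)
    rw [hR, div_mul_eq_mul_div, le_div_iff₀ hm]
    linarith
  refine ⟨fun x => w x - w 0, g, sub_self _, fun x => ?_, fun x y => ?_, fun x => ?_⟩
  · nlinarith [h4 x, sq_nonneg (‖g x‖ - 1)]
  · simpa using hg x y
  · have i1 : K * τ * (4 * M ^ 2 * ‖g x‖ ^ 2 + 8 * M ^ 2) ≤ K * τ * D := by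
      refine mul_le_mul_of_nonneg_left ?_ (by positivity)
      have := mul_le_mul_of_nonneg_left ((h4 x).trans (le_abs_self R))
        (by positivity : 0 ≤ 4 * M ^ 2)
      linarith
    linarith [h1 x]

/-- Existence of a `C^{1,1}` sub-solution at the critical level under `PhaseBounds`. -/
theorem exists_critical_subsolution [MeasurableSpace E] [BorelSpace E]
    (hH : PhaseBounds H m M C) :
    ∃ u : E → ℝ, Differentiable ℝ u ∧ (∃ K : ℝ≥0, LipschitzWith K (fun q => gradient u q)) ∧
      ∀ q, H q (gradient u q) ≤ sInf {a : ℝ | ∃ v : E → ℝ, (∃ K : ℝ≥0, LipschitzWith K v) ∧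
          ∀ x, DifferentiableAt ℝ v x → H x (gradient v x) ≤ a} := by
  set S := {a : ℝ | ∃ v : E → ℝ, (∃ K : ℝ≥0, LipschitzWith K v) ∧
          ∀ x, DifferentiableAt ℝ v x → H x (gradient v x) ≤ a} with hS
  have hne : S.Nonempty := by
    refine ⟨M, fun _ => 0, ⟨0, LipschitzWith.const 0⟩, fun x _ => ?_⟩
    have := hH.upper x 0
    rw [gradient_fun_const]
    simpa using this
  obtain ⟨K, R, hK, hreg⟩ := hH.exists_uniform_regularization (sInf S + 1)
  have hseq : ∀ j : ℕ, ∃ (w : E → ℝ) (g : E → E), w 0 = 0 ∧ (∀ x, ‖g x‖ ≤ R) ∧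
        (∀ x y, |w y - w x - ⟪g x, y - x⟫| ≤ K * ‖y - x‖ ^ 2) ∧
        ∀ x, H x (g x) ≤ sInf S + 3 * (1 / ((j : ℝ) + 1)) := fun j => by
    have hj : 0 < 1 / ((j : ℝ) + 1) := by positivity
    have hj1 : 1 / ((j : ℝ) + 1) ≤ 1 := by
      rw [div_le_one (by positivity)]; linarith [show (0 : ℝ) ≤ j from j.cast_nonneg]
    obtain ⟨α, ⟨v, hv, hvs⟩, hα⟩ := exists_lt_of_csInf_lt hne (lt_add_of_pos_right (sInf S) hj)
    obtain ⟨w, g, h0, h1, h2, h3⟩ := hreg α (by linarith) v hv hvs _ hj hj1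
    exact ⟨w, g, h0, h1, h2, fun x => by linarith [h3 x]⟩
  choose w g h0 h1 h2 h3 using hseq
  obtain ⟨W, G, hWG, hG⟩ := exists_limit_quadratic_tangent h0 h1 h2
  have hgrad : ∀ x, HasGradientAt W (G x) x := fun x =>
    hasGradientAt_of_quadratic_tangent (hWG x)
  have heq : ∀ x, gradient W x = G x := fun x => (hgrad x).gradient
  refine ⟨W, fun x => (hgrad x).hasFDerivAt.differentiableAt, ⟨⟨6 * K, by positivity⟩, ?_⟩, ?_⟩
  · refine LipschitzWith.of_dist_le_mul fun x y => ?_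
    rw [heq, heq, dist_eq_norm, dist_eq_norm]
    exact norm_sub_le_of_quadratic_tangent hK hWG x y
  · intro q
    rw [heq]
    have hcont : Continuous (H q) := (hH.convexOn q).locallyLipschitz.continuous
    have hlim : Filter.Tendsto (fun j : ℕ => sInf S + 3 * (1 / ((j : ℝ) + 1)))
        (Filter.hyperfilter ℕ) (nhds (sInf S + 3 * 0)) :=
      ((tendsto_one_div_add_atTop_nhds_zero_nat.mono_left Nat.hyperfilter_le_atTop).const_mul
        3).const_add _
    rw [mul_zero, add_zero] at hlim
    exact le_of_tendsto_of_tendsto' ((hcont.tendsto _).comp (hG q)) hlim fun j => h3 j q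

end PhaseBounds

end Critical

/-- There exists a `C^{1,1}` sub-solution at the critical level `α`,
the critical value being the infimum of the levels admitting a sub-solution. -/
theorem existence_of_C11_critical_subsolution {d : ℕ}
    (H : EuclideanSpace ℝ (Fin d) → EuclideanSpace ℝ (Fin d) → ℝ)
    (hH : ContDiff ℝ 2 (fun x : EuclideanSpace ℝ (Fin d) × EuclideanSpace ℝ (Fin d) =>
      H x.1 x.2))
    (m M : ℝ) (hm : 0 < m) (hmM : m ≤ M)
    (hd2H : ∀ x : EuclideanSpace ℝ (Fin d) × EuclideanSpace ℝ (Fin d),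
      ‖iteratedFDeriv ℝ 2
        (fun y : EuclideanSpace ℝ (Fin d) × EuclideanSpace ℝ (Fin d) => H y.1 y.2) x‖ ≤ M)
    (hconv : ∀ q p v : EuclideanSpace ℝ (Fin d),
      m * ‖v‖ ^ 2 ≤ iteratedFDeriv ℝ 2 (fun p' => H q p') p ![v, v])
    (hlower : ∀ q p : EuclideanSpace ℝ (Fin d), m / 2 * ‖p‖ ^ 2 - M ≤ H q p)
    (hupper : ∀ q p : EuclideanSpace ℝ (Fin d), H q p ≤ M / 2 * ‖p‖ ^ 2 + M) :
    ∃ u : EuclideanSpace ℝ (Fin d) → ℝ,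
      Differentiable ℝ u ∧
      (∃ K : ℝ≥0, LipschitzWith K (fun q => gradient u q)) ∧
      ∀ q, H q (gradient u q) ≤
        sInf {a : ℝ | ∃ v : EuclideanSpace ℝ (Fin d) → ℝ,
          (∃ K : ℝ≥0, LipschitzWith K v) ∧
          ∀ x, DifferentiableAt ℝ v x → H x (gradient v x) ≤ a} := by
  exact (phaseBounds_of_contDiff hH hm hmM hd2H hconv hlower hupper).exists_critical_subsolution
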